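/- Let (Â, B̂) be an optimal pair. Then there exist sets Â' ⊆ Â and B̂' ⊆ B̂, both simple, such that either (Â', B̂') is an optimal pair, or |B̂'| ≤ k and cost(B̂') equals the minimum of obj over P(k). -/

import Mathlib

open Finset

noncomputable section

/-- Cost of the assignment `π` (customer `j` is assigned to supplier `π j`)
when the suppliers in `A` are upgraded. -/
def assignCost {n : ℕ} (b c d : Fin n → ℝ) (A : Finset (Fin n))
    (π : Equiv.Perm (Fin n)) : ℝ :=
  ∑ j, (if π j ∈ A then b (π j) else c (π j)) * d j

/-- `cost A` : minimum assignment cost when upgrading the suppliers in `A`. -/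
def cost {n : ℕ} (b c d : Fin n → ℝ) (A : Finset (Fin n)) : ℝ :=
  Finset.univ.inf' Finset.univ_nonempty (assignCost b c d A)

/-- The LP feasible region `P(k)`. -/
def Pk (n k : ℕ) : Set ((Fin n → Fin n → ℝ) × (Fin n → Fin n → ℝ)) :=
  {p | (∀ i j, 0 ≤ p.1 i j) ∧ (∀ i j, 0 ≤ p.2 i j) ∧
    (∀ j, ∑ i, (p.1 i j + p.2 i j) = 1) ∧
    (∀ i, ∑ j, (p.1 i j + p.2 i j) = 1) ∧
    (∑ i, ∑ j, p.1 i j) ≤ (k : ℝ)}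

/-- The LP objective. -/
def obj {n : ℕ} (b c d : Fin n → ℝ)
    (p : (Fin n → Fin n → ℝ) × (Fin n → Fin n → ℝ)) : ℝ :=
  ∑ i, ∑ j, (b i * p.1 i j + c i * p.2 i j) * d j

/-- A point is integral if all of its entries lie in `{0, 1}`. -/
def Integral {n : ℕ} (p : (Fin n → Fin n → ℝ) × (Fin n → Fin n → ℝ)) : Prop :=
  (∀ i j, p.1 i j = 0 ∨ p.1 i j = 1) ∧ (∀ i j, p.2 i j = 0 ∨ p.2 i j = 1)

/-- `f_{A,B}(k)`. -/
def fpair {n : ℕ} (b c d : Fin n → ℝ) (k : ℕ) (A B : Finset (Fin n)) : ℝ :=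
  (((B.card : ℝ) - k) * cost b c d A + ((k : ℝ) - A.card) * cost b c d B) /
    ((B.card : ℝ) - A.card)

/-- `(A, B)` is an optimal pair. -/
def OptimalPair {n : ℕ} (b c d : Fin n → ℝ) (k : ℕ) (A B : Finset (Fin n)) : Prop :=
  A.card < k ∧ k < B.card ∧ IsLeast (obj b c d '' Pk n k) (fpair b c d k A B)

/-- `X` is simple: some optimal assignment for upgrading `X` assigns every
upgraded supplier to a customer with positive demand. -/
def SimpleSet {n : ℕ} (b c d : Fin n → ℝ) (X : Finset (Fin n)) : Prop :=
  ∃ π : Equiv.Perm (Fin n), assignCost b c d X π = cost b c d X ∧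
    ∀ j, π j ∈ X → 0 < d j

/-- `(A, B)` is clean. -/
def Clean {n : ℕ} (b c : Fin n → ℝ) (A B : Finset (Fin n)) : Prop :=
  ∀ i ∈ symmDiff A B, ∀ i' ∈ symmDiff A B, ¬ (b i < b i' ∧ c i' < c i)

/-- `(A', B')` is a redistribution of `(A, B)` : the elements of `A ∆ B` are
enumerated `e 0, e 1, …` with `b` and `c` both nondecreasing along the
enumeration, the elements with odd (0-based) index go to `A'` and those with
even (0-based) index go to `B'` (on top of `A ∩ B`). -/
def Redistribution {n : ℕ} (b c : Fin n → ℝ) (A B A' B' : Finset (Fin n)) : Prop :=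
  ∃ (ℓ : ℕ) (e : Fin ℓ → Fin n), Function.Injective e ∧
    Finset.image e Finset.univ = symmDiff A B ∧
    Monotone (b ∘ e) ∧ Monotone (c ∘ e) ∧
    A' = (A ∩ B) ∪
      Finset.image e ((Finset.univ : Finset (Fin ℓ)).filter (fun s => (s : ℕ) % 2 = 1)) ∧
    B' = (A ∩ B) ∪
      Finset.image e ((Finset.univ : Finset (Fin ℓ)).filter (fun s => (s : ℕ) % 2 = 0))

/-- The 0/1 point of the LP corresponding to assignment `π` with upgraded set `A`. -/
def chi {n : ℕ} (π : Equiv.Perm (Fin n)) (A : Finset (Fin n)) :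
    (Fin n → Fin n → ℝ) × (Fin n → Fin n → ℝ) :=
  (fun i j => if π j = i ∧ i ∈ A then 1 else 0,
   fun i j => if π j = i ∧ i ∉ A then 1 else 0)

/-- `hval k'` : minimum of `cost X` over all `X` of cardinality `k'`. -/
def hval {n : ℕ} (b c d : Fin n → ℝ) (k' : ℕ) : ℝ :=
  sInf {v | ∃ X : Finset (Fin n), X.card = k' ∧ cost b c d X = v}

end

theorem cost_le_assignCost {n : ℕ} (b c d : Fin n → ℝ) (A : Finset (Fin n))
    (π : Equiv.Perm (Fin n)) : cost b c d A ≤ assignCost b c d A π :=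
  Finset.inf'_le _ (Finset.mem_univ π)

theorem exists_assignCost_eq_cost {n : ℕ} (b c d : Fin n → ℝ) (A : Finset (Fin n)) :
    ∃ π : Equiv.Perm (Fin n), assignCost b c d A π = cost b c d A := by
  obtain ⟨π, -, h⟩ := Finset.exists_mem_eq_inf' Finset.univ_nonempty (assignCost b c d A)
  exact ⟨π, h.symm⟩

theorem cost_anti {n : ℕ} {b c d : Fin n → ℝ} (hbc : ∀ i, b i ≤ c i) (hd : ∀ j, 0 ≤ d j)
    {A B : Finset (Fin n)} (hAB : A ⊆ B) : cost b c d B ≤ cost b c d A := by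
  obtain ⟨π, hπ⟩ := exists_assignCost_eq_cost b c d A
  rw [← hπ]
  refine (cost_le_assignCost b c d B π).trans (Finset.sum_le_sum fun j _ => ?_)
  refine mul_le_mul_of_nonneg_right ?_ (hd j)
  by_cases hA : π j ∈ A
  · simp [hA, hAB hA]
  · by_cases hB : π j ∈ B <;> simp [hA, hB, hbc]

/-- Every set contains a simple set of the same cost: drop the suppliers that an optimal
assignment gives to customers without demand. -/
theorem exists_simpleSet_subset {n : ℕ} {b c d : Fin n → ℝ} (hbc : ∀ i, b i ≤ c i)
    (hd : ∀ j, 0 ≤ d j) (A : Finset (Fin n)) :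
    ∃ A' ⊆ A, SimpleSet b c d A' ∧ cost b c d A' = cost b c d A := by
  obtain ⟨π, hπ⟩ := exists_assignCost_eq_cost b c d A
  have hsub : A.filter (fun i => 0 < d (π.symm i)) ⊆ A := Finset.filter_subset _ _
  have hA' : assignCost b c d (A.filter fun i => 0 < d (π.symm i)) π = cost b c d A := by
    rw [← hπ]
    refine Finset.sum_congr rfl fun j _ => ?_
    rcases (hd j).eq_or_lt with h | h
    · simp [← h]
    · simp [h]
  have hcost := le_antisymm ((cost_le_assignCost _ _ _ _ π).trans hA'.le) (cost_anti hbc hd hsub)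
  refine ⟨_, hsub, ⟨π, hA'.trans hcost.symm, fun j hj => ?_⟩, hcost⟩
  simpa using (Finset.mem_filter.mp hj).2

theorem chi_mem_Pk {n : ℕ} (π : Equiv.Perm (Fin n)) (A : Finset (Fin n)) :
    chi π A ∈ Pk n A.card := by
  have hadd : ∀ i j, (chi π A).1 i j + (chi π A).2 i j = if π j = i then 1 else 0 := by
    intro i j
    by_cases h : π j = i <;> by_cases hA : i ∈ A <;> simp [chi, h, hA]
  refine ⟨fun i j => ?_, fun i j => ?_, fun j => ?_, fun i => ?_, ?_⟩
  · simp only [chi]; split_ifs <;> norm_num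
  · simp only [chi]; split_ifs <;> norm_num
  · simp [hadd]
  · simp [hadd, ← Equiv.eq_symm_apply]
  · have hrow : ∀ i, ∑ j, (chi π A).1 i j = if i ∈ A then 1 else 0 := by
      intro i
      by_cases hA : i ∈ A <;> simp [chi, hA, ← Equiv.eq_symm_apply]
    simp [hrow]

theorem obj_chi {n : ℕ} (b c d : Fin n → ℝ) (π : Equiv.Perm (Fin n)) (A : Finset (Fin n)) :
    obj b c d (chi π A) = assignCost b c d A π := by
  unfold obj assignCost
  rw [Finset.sum_comm]
  refine Finset.sum_congr rfl fun j _ => ?_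
  rw [Finset.sum_eq_single (π j)]
  · by_cases hA : π j ∈ A <;> simp [chi, hA]
  · intro i _ hi
    simp [chi, hi.symm]
  · simp

theorem obj_combo {n : ℕ} (b c d : Fin n → ℝ)
    (p q : (Fin n → Fin n → ℝ) × (Fin n → Fin n → ℝ)) (s t : ℝ) :
    obj b c d (s • p + t • q) = s * obj b c d p + t * obj b c d q := by
  simp only [obj, Finset.mul_sum, ← Finset.sum_add_distrib]
  refine Finset.sum_congr rfl fun i _ => Finset.sum_congr rfl fun j _ => ?_
  simp only [Prod.fst_add, Prod.snd_add, Prod.smul_fst, Prod.smul_snd, Pi.add_apply,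
    Pi.smul_apply, smul_eq_mul]
  ring

theorem combo_mem_Pk {n k l m : ℕ} {p q : (Fin n → Fin n → ℝ) × (Fin n → Fin n → ℝ)}
    (hp : p ∈ Pk n k) (hq : q ∈ Pk n l) {s t : ℝ} (hs : 0 ≤ s) (ht : 0 ≤ t) (hst : s + t = 1)
    (hm : s * k + t * l ≤ m) : s • p + t • q ∈ Pk n m := by
  obtain ⟨hp₁, hp₂, hpj, hpi, hpk⟩ := hp
  obtain ⟨hq₁, hq₂, hqj, hqi, hql⟩ := hq
  have hadd : ∀ i j, (s • p + t • q).1 i j + (s • p + t • q).2 i j =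
      s * (p.1 i j + p.2 i j) + t * (q.1 i j + q.2 i j) := by
    intro i j
    simp only [Prod.fst_add, Prod.snd_add, Prod.smul_fst, Prod.smul_snd, Pi.add_apply,
      Pi.smul_apply, smul_eq_mul]
    ring
  refine ⟨fun i j => ?_, fun i j => ?_, fun j => ?_, fun i => ?_, ?_⟩
  · exact add_nonneg (mul_nonneg hs (hp₁ i j)) (mul_nonneg ht (hq₁ i j))
  · exact add_nonneg (mul_nonneg hs (hp₂ i j)) (mul_nonneg ht (hq₂ i j))
  · simp only [hadd, Finset.sum_add_distrib, ← Finset.mul_sum] at hpj hqj ⊢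
    rw [hpj, hqj, mul_one, mul_one, hst]
  · simp only [hadd, Finset.sum_add_distrib, ← Finset.mul_sum] at hpi hqi ⊢
    rw [hpi, hqi, mul_one, mul_one, hst]
  · refine le_trans (le_of_eq ?_) ((add_le_add (mul_le_mul_of_nonneg_left hpk hs)
      (mul_le_mul_of_nonneg_left hql ht)).trans hm)
    simp [Finset.sum_add_distrib, Finset.mul_sum]

theorem combo_cost_mem_image {n k : ℕ} (b c d : Fin n → ℝ) (A B : Finset (Fin n)) {s t : ℝ}
    (hs : 0 ≤ s) (ht : 0 ≤ t) (hst : s + t = 1) (hk : s * A.card + t * B.card ≤ k) :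
    s * cost b c d A + t * cost b c d B ∈ obj b c d '' Pk n k := by
  obtain ⟨π, hπ⟩ := exists_assignCost_eq_cost b c d A
  obtain ⟨σ, hσ⟩ := exists_assignCost_eq_cost b c d B
  refine ⟨s • chi π A + t • chi σ B,
    combo_mem_Pk (chi_mem_Pk π A) (chi_mem_Pk σ B) hs ht hst hk, ?_⟩
  rw [obj_combo, obj_chi, obj_chi, hπ, hσ]

theorem cost_mem_image {n k : ℕ} (b c d : Fin n → ℝ) {A : Finset (Fin n)} (hk : A.card ≤ k) :
    cost b c d A ∈ obj b c d '' Pk n k := by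
  have h : (A.card : ℝ) ≤ k := by exact_mod_cast hk
  simpa using combo_cost_mem_image (k := k) b c d A A zero_le_one le_rfl (add_zero 1)
    (by simpa using h)

theorem fpair_mem_image {n k : ℕ} (b c d : Fin n → ℝ) {A B : Finset (Fin n)}
    (hA : A.card < k) (hB : k < B.card) : fpair b c d k A B ∈ obj b c d '' Pk n k := by
  have hA : (A.card : ℝ) < k := by exact_mod_cast hA
  have hB : (k : ℝ) < B.card := by exact_mod_cast hB
  have hpos : (0 : ℝ) < (B.card : ℝ) - A.card := by linarith
  have h := combo_cost_mem_image (k := k) b c d A B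
    (s := ((B.card : ℝ) - k) / ((B.card : ℝ) - A.card))
    (t := ((k : ℝ) - A.card) / ((B.card : ℝ) - A.card))
    (div_nonneg (by linarith) hpos.le) (div_nonneg (by linarith) hpos.le)
    (by field_simp; ring) (le_of_eq (by field_simp; ring))
  convert h using 1
  unfold fpair
  ring

/-- an optimal pair can be simplified: there are simple subsets
forming an optimal pair, or a simple subset of `B̂` of cardinality at most `k`
whose cost is the LP optimum. -/
theorem stmt4 (n : ℕ) (hn : 1 ≤ n) (b c d : Fin n → ℝ)
    (hb : ∀ i, 0 ≤ b i) (hbc : ∀ i, b i ≤ c i) (hd : ∀ j, 0 ≤ d j) (k : ℕ)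
    (Ah Bh : Finset (Fin n)) (hopt : OptimalPair b c d k Ah Bh) :
    ∃ (Ah' Bh' : Finset (Fin n)), Ah' ⊆ Ah ∧ Bh' ⊆ Bh ∧
      SimpleSet b c d Ah' ∧ SimpleSet b c d Bh' ∧
      (OptimalPair b c d k Ah' Bh' ∨
        (Bh'.card ≤ k ∧ IsLeast (obj b c d '' Pk n k) (cost b c d Bh'))) := by
  obtain ⟨hA, hB, hleast⟩ := hopt
  obtain ⟨A', hA'sub, hA'simple, hA'cost⟩ := exists_simpleSet_subset hbc hd Ah
  obtain ⟨B', hB'sub, hB'simple, hB'cost⟩ := exists_simpleSet_subset hbc hd Bh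
  have hA'A := Finset.card_le_card hA'sub
  have hB'B := Finset.card_le_card hB'sub
  have hAk : (Ah.card : ℝ) < k := by exact_mod_cast hA
  have hkB : (k : ℝ) < Bh.card := by exact_mod_cast hB
  have hpos : (0 : ℝ) < (Bh.card : ℝ) - Ah.card := by linarith
  have hBA : cost b c d Bh ≤ cost b c d Ah := by
    have h := hleast.2 (cost_mem_image b c d hA.le)
    rw [fpair, div_le_iff₀ hpos] at h
    have hk : (0 : ℝ) < k - Ah.card := by linarith
    refine le_of_mul_le_mul_left ?_ hk
    linarith
  refine ⟨A', B', hA'sub, hB'sub, hA'simple, hB'simple, ?_⟩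
  rcases lt_or_ge k B'.card with hk | hk
  · have hA'k : A'.card < k := hA'A.trans_lt hA
    refine Or.inl ⟨hA'k, hk, fpair_mem_image b c d hA'k hk, fun v hv => le_trans ?_ (hleast.2 hv)⟩
    have h₁ : (A'.card : ℝ) ≤ Ah.card := by exact_mod_cast hA'A
    have h₂ : (B'.card : ℝ) ≤ Bh.card := by exact_mod_cast hB'B
    have h₃ : (k : ℝ) < B'.card := by exact_mod_cast hk
    have hpos' : (0 : ℝ) < (B'.card : ℝ) - A'.card := by linarith
    rw [fpair, fpair, hA'cost, hB'cost, div_le_div_iff₀ hpos' hpos]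
    have hweight : 0 ≤ ((Bh.card : ℝ) - k) * ((Ah.card : ℝ) - A'.card) +
        ((Bh.card : ℝ) - B'.card) * ((k : ℝ) - Ah.card) :=
      add_nonneg (mul_nonneg (by linarith) (by linarith))
        (mul_nonneg (by linarith) (by linarith))
    have hmul := mul_nonneg hweight (sub_nonneg.mpr hBA)
    linear_combination hmul
  · refine Or.inr ⟨hk, cost_mem_image b c d hk, fun v hv => le_trans ?_ (hleast.2 hv)⟩
    rw [hB'cost, fpair, le_div_iff₀ hpos]
    nlinarith
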